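/- Suppose (I_1,…,I_s) satisfies the RIP and let A be the arc set produced by Algorithm 1. For each k ∈ [n] let Q_k := {i ∈ [s] : k ∈ I_i} and P_k := {(i,t) ∈ A : k ∈ C_{i,t}}. Then the undirected graph with vertex set Q_k and edge set {{i,t} : (i,t) ∈ P_k} is connected, i.e., any two elements of Q_k are joined by a path of such edges. -/

import Mathlib

open MvPolynomial Finset
open scoped Classical

noncomputable section

/-- Union of the earlier blocks `J 0, …, J (i-1)`. -/
def prevUnion {s : ℕ} {α : Type*} (J : Fin s → Finset α) (i : Fin s) : Finset α :=
  (Finset.univ.filter (fun j => j < i)).biUnion J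

/-- The arc relation produced by Algorithm 1: `(i, t)` is an arc iff `t < i`,
the intersection of `I i` with the union of the earlier blocks is nonempty and
contained in `I t`, and `t` is the largest such index. -/
def Arc {n s : ℕ} (I : Fin s → Finset (Fin n)) (i t : Fin s) : Prop :=
  t < i ∧ (I i ∩ prevUnion I i).Nonempty ∧ I i ∩ prevUnion I i ⊆ I t ∧
    ∀ t' : Fin s, t < t' → t' < i → ¬ I i ∩ prevUnion I i ⊆ I t'

/-- The running intersection property. -/
def RIP {n s : ℕ} (I : Fin s → Finset (Fin n)) : Prop :=
  ∀ i : Fin s, 0 < (i : ℕ) → ∃ t : Fin s, t < i ∧ I i ∩ prevUnion I i ⊆ I t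

theorem mem_prevUnion {s : ℕ} {α : Type*} {J : Fin s → Finset α} {i j : Fin s} {x : α}
    (hji : j < i) (hx : x ∈ J j) : x ∈ prevUnion J i :=
  mem_biUnion.2 ⟨j, by simpa using hji, hx⟩

/-- If `k` lies in block `i` and in some earlier block, then `i` has an arc to an earlier block
containing `k`. -/
theorem exists_arc_of_mem {n s : ℕ} {I : Fin s → Finset (Fin n)} (hrip : RIP I)
    {k : Fin n} {i j : Fin s} (hji : j < i) (hi : k ∈ I i) (hj : k ∈ I j) :
    ∃ t : Fin s, Arc I i t ∧ k ∈ I t := by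
  have hk : k ∈ I i ∩ prevUnion I i :=
    mem_inter.2 ⟨hi, mem_prevUnion hji hj⟩
  obtain ⟨t₀, ht₀, hsub₀⟩ := hrip i (Nat.zero_lt_of_lt hji)
  obtain ⟨t, ⟨ht, hsub⟩, hmax⟩ :=
    WellFounded.has_min (wellFounded_gt (α := Fin s))
      {t | t < i ∧ I i ∩ prevUnion I i ⊆ I t} ⟨t₀, ht₀, hsub₀⟩
  exact ⟨t, ⟨ht, ⟨k, hk⟩, hsub, fun t' htt' ht' h => hmax t' ⟨ht', h⟩ htt'⟩, hsub hk⟩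

/-- for each variable index `k`, the subgraph on
`Q_k = {i : k ∈ I i}` with edges `{i,t}` for arcs `(i,t) ∈ A` with `k ∈ C_{i,t}`
is connected: any two elements of `Q_k` are joined by a path of such edges. -/
theorem cs_lme_subtree_connected
    (n s : ℕ) (I : Fin s → Finset (Fin n))
    (hcover : ∀ k : Fin n, ∃ i, k ∈ I i) (hrip : RIP I)
    (k : Fin n) (a b : Fin s) (ha : k ∈ I a) (hb : k ∈ I b) :
    Relation.ReflTransGen
      (fun u w => (Arc I u w ∨ Arc I w u) ∧ k ∈ I u ∩ I w) a b := by
  have hsymm : Std.Symm (fun u w => (Arc I u w ∨ Arc I w u) ∧ k ∈ I u ∩ I w) :=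
    ⟨fun u w h => ⟨h.1.symm, by rw [inter_comm]; exact h.2⟩⟩
  obtain ⟨m, hm, hmin⟩ := WellFounded.has_min (wellFounded_lt (α := Fin s))
    {i | k ∈ I i} ⟨a, ha⟩
  have reach : ∀ i, k ∈ I i → Relation.ReflTransGen
      (fun u w => (Arc I u w ∨ Arc I w u) ∧ k ∈ I u ∩ I w) i m := by
    intro i
    induction i using WellFoundedLT.induction with
    | ind i ih =>
      intro hi
      rcases (not_lt.1 (hmin i hi)).eq_or_lt with rfl | hlt
      · exact .refl
      · obtain ⟨t, harc, ht⟩ := exists_arc_of_mem hrip hlt hi hm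
        exact .head ⟨.inl harc, mem_inter.2 ⟨hi, ht⟩⟩ (ih t harc.1 ht)
  exact (reach a ha).trans (Std.Symm.symm _ _ (reach b hb))
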